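/- Let R be a one-dimensional Noetherian local domain whose integral closure B in its fraction field is a finite R-module. Then every integrally closed ideal of R is reflexive. In particular, for any ideal I of R, its bidual (I^{-1})^{-1} is contained in the integral closure of I. -/

import Mathlib

/-- `x` is integral over the ideal `I`: it satisfies an equation
`x^m + b_1 x^{m-1} + ... + b_m = 0` with `b_j ∈ I^j` and `m ≥ 1`. -/
def Ideal.IsIntegralElem' {R : Type*} [CommRing R] (I : Ideal R) (x : R) : Prop :=
  ∃ m : ℕ, 0 < m ∧ ∃ b : ℕ → R, (∀ j, 1 ≤ j → j ≤ m → b j ∈ I ^ j) ∧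
    x ^ m + ∑ j ∈ Finset.Icc 1 m, b j * x ^ (m - j) = 0

/-- The integral closure of an ideal, as an ideal.  (Since the set of elements integral
over `I` is an ideal, taking the span adds nothing.) -/
def Ideal.intClosure {R : Type*} [CommRing R] (I : Ideal R) : Ideal R :=
  Ideal.span {x | I.IsIntegralElem' x}

/-- An ideal is integrally closed if it contains every element integral over it. -/
def Ideal.IsIntClosed {R : Type*} [CommRing R] (I : Ideal R) : Prop :=
  ∀ x, I.IsIntegralElem' x → x ∈ I

/-- The minimal number of generators of an ideal. -/
noncomputable def Ideal.mu {R : Type*} [CommRing R] (I : Ideal R) : ℕ :=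
  sInf {n | ∃ f : Fin n → R, Ideal.span (Set.range f) = I}

variable {R : Type*} [CommRing R] [IsDomain R]

/-- The dual `S⁻¹ = {x ∈ K : x S ⊆ R}` of a submodule `S` of the fraction field `K`. -/
noncomputable def dualSub (S : Submodule R (FractionRing R)) :
    Submodule R (FractionRing R) where
  carrier := {x | ∀ s ∈ S, ∃ r : R, algebraMap R (FractionRing R) r = x * s}
  zero_mem' := fun s _ => ⟨0, by simp⟩
  add_mem' := by
    intro x y hx hy s hs
    obtain ⟨r₁, h₁⟩ := hx s hs
    obtain ⟨r₂, h₂⟩ := hy s hs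
    exact ⟨r₁ + r₂, by rw [map_add, h₁, h₂, add_mul]⟩
  smul_mem' := by
    intro c x hx s hs
    obtain ⟨r, hr⟩ := hx s hs
    exact ⟨c * r, by rw [map_mul, hr, Algebra.smul_def, mul_assoc]⟩

/-- The dual `I⁻¹` of an ideal `I`, as a submodule of the fraction field. -/
noncomputable def idealDual (I : Ideal R) : Submodule R (FractionRing R) :=
  dualSub (Submodule.map (Algebra.linearMap R (FractionRing R)) I)

/-- The bidual `(I⁻¹)⁻¹` of an ideal `I`, as a submodule of the fraction field. -/
noncomputable def idealBidual (I : Ideal R) : Submodule R (FractionRing R) :=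
  dualSub (idealDual I)

open scoped nonZeroDivisors

/-- An element of the base ring lying in the extension of `I` to a finite faithful algebra is
integral over `I`. -/
theorem Ideal.isIntegralElem'_of_algebraMap_mem_map {R B : Type*} [CommRing R] [Nontrivial R]
    [CommRing B] [Algebra R B] [Module.Finite R B] [FaithfulSMul R B] {I : Ideal R} {r : R}
    (hr : algebraMap R B r ∈ I.map (algebraMap R B)) : I.IsIntegralElem' r := by
  obtain ⟨p, hp, -, hcoeff, heval⟩ :=
    LinearMap.exists_monic_and_natDegree_eq_and_coeff_mem_pow_and_aeval_eq_zero _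
      (algebraMap R (Module.End R B) r) I (by
        rintro _ ⟨b, rfl⟩
        rw [Ideal.smul_top_eq_map, Submodule.restrictScalars_mem, Module.algebraMap_end_apply,
          Algebra.smul_def]
        exact Ideal.mul_mem_right _ _ hr)
  have hroot : p.eval r = 0 := by
    rw [Polynomial.aeval_algebraMap_apply, Polynomial.coe_aeval_eq_eval] at heval
    have h := LinearMap.congr_fun heval 1
    rw [Module.algebraMap_end_apply, ← Algebra.algebraMap_eq_smul_one, LinearMap.zero_apply] at h
    exact (FaithfulSMul.algebraMap_eq_zero_iff R B).mp h
  refine ⟨p.natDegree, Nat.pos_of_ne_zero fun h => ?_, fun j => p.coeff (p.natDegree - j),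
    fun j _ hj => ?_, ?_⟩
  · rw [hp.natDegree_eq_zero.mp h, Polynomial.eval_one] at hroot
    exact one_ne_zero hroot
  · simpa [Nat.sub_sub_self hj] using hcoeff (p.natDegree - j)
  · rw [← hroot, Polynomial.eval_eq_sum_range, Finset.sum_range_succ, hp.coeff_natDegree, one_mul,
      add_comm]
    congr 1
    refine Finset.sum_nbij' (p.natDegree - ·) (p.natDegree - ·) ?_ ?_ ?_ ?_ (fun _ _ => rfl) <;>
      simp only [Finset.mem_Icc, Finset.mem_range] <;> omega

theorem le_idealBidual {R : Type*} [CommRing R] (I : Ideal R) :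
    Submodule.map (Algebra.linearMap R (FractionRing R)) I ≤ idealBidual I := by
  intro x hx y hy
  obtain ⟨r, hr⟩ := hy x hx
  exact ⟨r, by rw [hr, mul_comm]⟩

theorem exists_algebraMap_eq_of_mem_idealBidual {R : Type*} [CommRing R]
    {I : Ideal R} {x : FractionRing R} (hx : x ∈ idealBidual I) :
    ∃ r : R, algebraMap R (FractionRing R) r = x := by
  have h1 : (1 : FractionRing R) ∈ idealDual I := by
    rintro _ ⟨r, -, rfl⟩
    exact ⟨r, by simp⟩
  simpa using hx 1 h1

theorem eq_zero_of_mem_idealBidual_bot (hR : ¬ IsField R) {x : FractionRing R}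
    (hx : x ∈ idealBidual (⊥ : Ideal R)) : x = 0 := by
  have htop (y : FractionRing R) : y ∈ idealDual (⊥ : Ideal R) := by
    rintro _ ⟨r, hr, rfl⟩
    exact ⟨0, by simp [(Submodule.mem_bot R).mp hr]⟩
  by_contra hx0
  refine hR ((IsFractionRing.surjective_iff_isField (R := R) (K := (FractionRing R))).mp fun y => ?_)
  obtain ⟨r, hr⟩ := hx (x⁻¹ * y) (htop _)
  exact ⟨r, by rw [hr, mul_inv_cancel_left₀ hx0]⟩

/-- The conductor `R : B` of the integral closure `B` of `R` in its fraction field. -/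
noncomputable def conductorSub (R : Type*) [CommRing R] [IsDomain R] :
    Submodule R (FractionRing R) :=
  dualSub (Subalgebra.toSubmodule (integralClosure R (FractionRing R)))

theorem mul_mem_conductorSub {c b : FractionRing R} (hc : c ∈ conductorSub R)
    (hb : b ∈ integralClosure R (FractionRing R)) :
    c * b ∈ conductorSub R := by
  intro s hs
  obtain ⟨r, hr⟩ := hc (b * s) ((integralClosure R (FractionRing R)).mul_mem hb hs)
  exact ⟨r, by rw [hr, mul_assoc]⟩

theorem conductorSub_fg [IsNoetherianRing R] : (conductorSub R).FG := by
  have hle : conductorSub R ≤ Submodule.map (Algebra.linearMap R (FractionRing R)) ⊤ := by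
    intro c hc
    obtain ⟨r, hr⟩ := hc 1 (integralClosure R (FractionRing R)).one_mem
    exact ⟨r, trivial, by simpa using hr⟩
  have : IsNoetherian R (Submodule.map (Algebra.linearMap R (FractionRing R)) ⊤) :=
    isNoetherian_of_fg_of_noetherian _ ((IsNoetherian.noetherian _).map _)
  have := isNoetherian_of_le hle
  exact (Submodule.fg_top _).mp (IsNoetherian.noetherian ⊤)

theorem conductorSub_ne_bot (hfin : Module.Finite R (integralClosure R (FractionRing R))) :
    conductorSub R ≠ ⊥ := by
  obtain ⟨a, ha, h⟩ := FractionalIdeal.isFractional_of_fg (S := R⁰)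
    (Module.Finite.iff_fg (N := Subalgebra.toSubmodule (integralClosure R (FractionRing R))).mp hfin)
  refine (Submodule.ne_bot_iff _).mpr ⟨algebraMap R (FractionRing R) a, fun s hs => ?_, ?_⟩
  · obtain ⟨r, hr⟩ := h s hs
    exact ⟨r, by rw [hr, Algebra.smul_def]⟩
  · simpa using nonZeroDivisors.ne_zero ha

theorem isDedekindDomain_integralClosure_fractionRing [IsNoetherianRing R]
    [Ring.DimensionLEOne R] (hfin : Module.Finite R (integralClosure R (FractionRing R))) :
    IsDedekindDomain (integralClosure R (FractionRing R)) := by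
  have : IsIntegrallyClosed (integralClosure R (FractionRing R)) :=
    integralClosure.isIntegrallyClosedOfFiniteExtension (FractionRing R)
  have : IsNoetherianRing (integralClosure R (FractionRing R)) := .of_finite R _
  exact {}

/-- The bidual of a nonzero ideal `I` is contained in the extension of `I` to the integral
closure of `R`. -/
theorem mem_map_of_mem_idealBidual [IsNoetherianRing R] [Ring.DimensionLEOne R]
    (hfin : Module.Finite R (integralClosure R (FractionRing R))) {I : Ideal R} (hI : I ≠ ⊥) {r : R}
    (hr : algebraMap R (FractionRing R) r ∈ idealBidual I) :
    algebraMap R (integralClosure R (FractionRing R)) r ∈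
      I.map (algebraMap R (integralClosure R (FractionRing R))) := by
  have := isDedekindDomain_integralClosure_fractionRing hfin
  have : IsFractionRing (integralClosure R (FractionRing R)) (FractionRing R) :=
    integralClosure.isFractionRing_of_finite_extension (FractionRing R) (FractionRing R)
  set B := integralClosure R (FractionRing R)
  set J : FractionalIdeal B⁰ (FractionRing R) :=
    ((I.map (algebraMap R B) : Ideal B) : FractionalIdeal B⁰ (FractionRing R)) with hJ
  have hJ0 : J ≠ 0 := by
    rw [hJ, FractionalIdeal.coeIdeal_ne_zero]
    exact (Ideal.map_eq_bot_iff_of_injective (FaithfulSMul.algebraMap_injective R B)).not.mpr hI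
  have hle : FractionalIdeal.spanSingleton B⁰ (algebraMap R (FractionRing R) r) * J⁻¹ ≤ 1 := by
    rw [FractionalIdeal.spanSingleton_mul_le_iff]
    intro k hk
    rw [FractionalIdeal.mem_inv_iff hJ0] at hk
    have hdual {c : FractionRing R} (hc : c ∈ conductorSub R) : k * c ∈ idealDual I := by
      rintro _ ⟨i, hi, rfl⟩
      obtain ⟨b, hb⟩ := (FractionalIdeal.mem_one_iff B⁰).mp
        (hk _ (FractionalIdeal.mem_coeIdeal_of_mem B⁰ (Ideal.mem_map_of_mem (algebraMap R B) hi)))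
      obtain ⟨s, hs⟩ := hc b b.2
      refine ⟨s, hs.trans ?_⟩
      change c * algebraMap B (FractionRing R) b = k * c * algebraMap R (FractionRing R) i
      rw [hb, ← IsScalarTower.algebraMap_apply]
      ring
    have hint : IsIntegral R (algebraMap R (FractionRing R) r * k) := by
      refine isIntegral_of_smul_mem_submodule (conductorSub R) (conductorSub_ne_bot hfin)
        conductorSub_fg _ fun c hc s hs => ?_
      obtain ⟨t, ht⟩ := hr _ (hdual (mul_mem_conductorSub hc hs))
      exact ⟨t, by rw [ht, smul_eq_mul]; ring⟩
    exact (FractionalIdeal.mem_one_iff B⁰).mpr ⟨⟨_, hint⟩, rfl⟩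
  have hmem : algebraMap R (FractionRing R) r ∈ J := by
    rw [← FractionalIdeal.spanSingleton_le_iff_mem]
    calc _ = FractionalIdeal.spanSingleton B⁰ (algebraMap R (FractionRing R) r) * J⁻¹ * J := by
          rw [mul_assoc, inv_mul_cancel₀ hJ0, mul_one]
      _ ≤ 1 * J := mul_le_mul_left hle J
      _ = J := one_mul J
  obtain ⟨b, hb, hbr⟩ := (FractionalIdeal.mem_coeIdeal B⁰).mp hmem
  rw [IsScalarTower.algebraMap_apply R B (FractionRing R)] at hbr
  rwa [← FaithfulSMul.algebraMap_injective B (FractionRing R) hbr]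

theorem exists_isIntegralElem'_of_mem_idealBidual [IsNoetherianRing R] [Ring.DimensionLEOne R]
    (hR : ¬ IsField R) (hfin : Module.Finite R (integralClosure R (FractionRing R)))
    {I : Ideal R} {x : FractionRing R} (hx : x ∈ idealBidual I) :
    ∃ r : R, algebraMap R (FractionRing R) r = x ∧ I.IsIntegralElem' r := by
  by_cases hI : I = ⊥
  · subst hI
    exact ⟨0, by simp [eq_zero_of_mem_idealBidual_bot hR hx], 1, one_pos, 0, by simp, by simp⟩
  · obtain ⟨r, rfl⟩ := exists_algebraMap_eq_of_mem_idealBidual hx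
    exact ⟨r, rfl, Ideal.isIntegralElem'_of_algebraMap_mem_map
      (mem_map_of_mem_idealBidual hfin hI hx)⟩

set_option synthInstance.maxHeartbeats 1000000 in
/-- **Proposition.**  Let `R` be a one-dimensional Noetherian local domain whose
integral closure in its fraction field is a finite `R`-module.  Then every integrally
closed ideal of `R` is reflexive (i.e. `(I⁻¹)⁻¹ = I`), and for any ideal `I` the bidual
`(I⁻¹)⁻¹` is contained in the integral closure of `I`. -/
theorem intClosed_reflexive_and_bidual_le_intClosure
    (R : Type*) [CommRing R] [IsDomain R] [IsNoetherianRing R] [IsLocalRing R]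
    (hdim : ringKrullDim R = 1)
    (hfin : Module.Finite R (integralClosure R (FractionRing R))) :
    (∀ I : Ideal R, I.IsIntClosed →
        idealBidual I = Submodule.map (Algebra.linearMap R (FractionRing R)) I) ∧
      ∀ (I : Ideal R), ∀ x ∈ idealBidual I,
        ∃ r : R, algebraMap R (FractionRing R) r = x ∧ I.IsIntegralElem' r := by
  have hdimle : Ring.KrullDimLE 1 R := Ring.krullDimLE_iff.mpr (by simp [hdim])
  have : Ring.DimensionLEOne R :=
    ⟨fun h hp => Ring.krullDimLE_one_iff_of_noZeroDivisors.mp hdimle _ h hp⟩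
  have hR : ¬ IsField R := fun h =>
    zero_ne_one ((ringKrullDim_eq_zero_of_isField h).symm.trans hdim)
  refine ⟨fun I hI => le_antisymm (fun x hx => ?_) (le_idealBidual I),
    fun I x hx => exists_isIntegralElem'_of_mem_idealBidual hR hfin hx⟩
  obtain ⟨r, rfl, hr⟩ := exists_isIntegralElem'_of_mem_idealBidual hR hfin hx
  exact ⟨r, hI r hr, rfl⟩
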